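/- Let λ be the cardinal defined by λ_0 = ℵ₀, λ_{n+1} = 2^{λ_n}, λ = sup_n λ_n, and let Λ be a set of cardinality λ. For each n ∈ ℕ let [Λ]^{≤n} denote the space of subsets of Λ of cardinality at most n, identified with their characteristic functions and topologized as a subspace of the product space {0,1}^Λ, and let K_λ be the one-point (Alexandroff) compactification of the topological disjoint sum of the spaces [Λ]^{≤n}, n ∈ ℕ. Then for every set Γ there is no uniform embedding of the Banach space C(K_λ) of continuous real-valued functions on K_λ (with the supremum norm) into c₀(Γ). -/

import Mathlib

open Cardinal ZeroAtInfty

/-- The sequence `λ₀ = ℵ₀`, `λ_{n+1} = 2 ^ λ_n`. -/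
def lamSeq : ℕ → Cardinal
  | 0 => ℵ₀
  | n + 1 => 2 ^ lamSeq n

/-- The cardinal `λ = sup_n λ_n`. -/
noncomputable def lam : Cardinal := ⨆ n, lamSeq n

/-- `[Λ]^{≤n}`: the subsets of `Λ` of cardinality at most `n`, identified with their
characteristic functions and topologized as a subspace of `{0,1}^Λ` (product topology,
`Bool` discrete). -/
def smallSets (Λ : Type*) (n : ℕ) : Type _ :=
  {g : Λ → Bool // {γ | g γ = true}.Finite ∧ {γ | g γ = true}.ncard ≤ n}

instance (Λ : Type*) (n : ℕ) : TopologicalSpace (smallSets Λ n) :=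
  instTopologicalSpaceSubtype

/-- `K_λ`: the one-point (Alexandroff) compactification of the topological disjoint
sum of the spaces `[Λ]^{≤n}`, `n ∈ ℕ`. -/
def Klam (Λ : Type*) : Type _ := OnePoint (Σ n : ℕ, smallSets Λ n)

instance (Λ : Type*) : TopologicalSpace (Klam Λ) :=
  inferInstanceAs (TopologicalSpace (OnePoint (Σ n : ℕ, smallSets Λ n)))

instance (Λ : Type*) : CompactSpace (Klam Λ) :=
  inferInstanceAs (CompactSpace (OnePoint (Σ n : ℕ, smallSets Λ n)))

lemma aleph0_le_lamSeq (n : ℕ) : ℵ₀ ≤ lamSeq n := by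
  induction n with
  | zero => exact le_rfl
  | succ n ih => exact ih.trans (Cardinal.cantor _).le

lemma lamSeq_le_lam (n : ℕ) : lamSeq n ≤ lam := le_ciSup (Cardinal.bddAbove_of_small) n

/-- If, for every finite set `b`, a colouring of finite sets takes finitely many values on the
one-point extensions of `b`, then two disjoint sets of size `n` get the same colour. -/
lemma exists_disjoint_eq_color {Λ : Type*} {I : Type*} [DecidableEq Λ] (n : ℕ) :
    ∀ S : Set Λ, lamSeq n ≤ #S → ∀ c : Finset Λ → I,
      (∀ b, (Set.range fun t => c (insert t b)).Finite) →
      ∃ a b : Finset Λ, (a : Set Λ) ⊆ S ∧ (b : Set Λ) ⊆ S ∧ Disjoint a b ∧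
        a.card = n ∧ b.card = n ∧ c a = c b := by
  induction n with
  | zero => exact fun S _ c _ => ⟨∅, ∅, by simp⟩
  | succ n ih =>
    intro S hS c hc
    obtain ⟨S₀, hS₀, hcard⟩ := Cardinal.le_mk_iff_exists_subset.1
      ((Cardinal.cantor (lamSeq n)).le.trans hS)
    have hlt : #S₀ < #S := hcard ▸ (Cardinal.cantor _).trans_le hS
    have hinf : Infinite S₀ := Cardinal.infinite_iff.2 (hcard ▸ aleph0_le_lamSeq n)
    have hdiff : #S₀ < #(S \ S₀ : Set Λ) := by
      by_contra! h
      have h1 := Cardinal.mk_union_le S₀ (S \ S₀)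
      rw [Set.union_sdiff_cancel hS₀] at h1
      exact absurd (h1.trans (Cardinal.add_le_of_le (Cardinal.infinite_iff.1 hinf) le_rfl h))
        hlt.not_ge
    have key : ∀ t : (S \ S₀ : Set Λ), ∃ p : Finset S₀ × Finset S₀, Disjoint p.1 p.2 ∧
        p.1.card = n ∧ p.2.card = n ∧
        c (insert t.1 (p.1.map (.subtype _))) = c (insert t.1 (p.2.map (.subtype _))) := by
      intro t
      obtain ⟨a, b, ha, hb, hab, hca, hcb, h⟩ := ih S₀ hcard.ge (fun a => c (insert t.1 a))
        (fun b => (hc (insert t.1 b)).subset (by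
          rintro _ ⟨u, rfl⟩
          exact ⟨u, by simp only [Finset.insert_comm]⟩))
      lift a to Finset S₀ using ha
      lift b to Finset S₀ using hb
      have himg : ∀ d : Finset S₀, d.image Subtype.val = d.map (.subtype _) := fun d =>
        (Finset.map_eq_image (.subtype _) d).symm
      simp only [himg] at hca hcb hab h
      rw [Finset.card_map] at hca hcb
      rw [Finset.disjoint_map] at hab
      exact ⟨(a, b), hab, hca, hcb, h⟩
    choose p hp using key
    have : Infinite (S \ S₀ : Set Λ) :=
      Cardinal.infinite_iff.2 ((Cardinal.infinite_iff.1 hinf).trans hdiff.le)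
    obtain ⟨⟨a, b⟩, hab⟩ := Cardinal.exists_infinite_fiber p (by simpa using hdiff)
    have hfin : Set.Finite (Set.range fun t : p ⁻¹' {(a, b)} =>
        c (insert t.1.1 (a.map (.subtype _)))) :=
      (hc (a.map (.subtype _))).subset (by rintro _ ⟨u, rfl⟩; exact ⟨_, rfl⟩)
    have : Finite (Set.range fun t : p ⁻¹' {(a, b)} => c (insert t.1.1 (a.map (.subtype _)))) :=
      hfin
    obtain ⟨t, u, htu, heq⟩ := Finite.exists_ne_map_eq_of_infinite
      (Set.rangeFactorization fun t : p ⁻¹' {(a, b)} => c (insert t.1.1 (a.map (.subtype _))))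
    replace heq := congrArg Subtype.val heq
    simp only [Set.rangeFactorization_coe] at heq
    have hu := hp u.1
    rw [show p u.1 = (a, b) from u.2] at hu
    obtain ⟨hd, ha, hb, hcu⟩ := hu
    have hnot : ∀ (v : (S \ S₀ : Set Λ)) (d : Finset S₀), v.1 ∉ d.map (.subtype _) := by
      intro v d hv
      obtain ⟨w, -, hw⟩ := Finset.mem_map.1 hv
      exact v.2.2 (hw ▸ w.2)
    have hsub : ∀ (v : (S \ S₀ : Set Λ)) (d : Finset S₀),
        ((insert v.1 (d.map (.subtype _)) : Finset Λ) : Set Λ) ⊆ S := by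
      intro v d w hw
      rcases Finset.mem_insert.1 (Finset.mem_coe.1 hw) with rfl | hw
      · exact v.2.1
      · obtain ⟨w, -, rfl⟩ := Finset.mem_map.1 hw
        exact hS₀ w.2
    refine ⟨insert t.1.1 (a.map (.subtype _)), insert u.1.1 (b.map (.subtype _)), hsub _ _,
      hsub _ _, ?_, ?_, ?_, heq.trans hcu⟩
    · rw [Finset.disjoint_insert_left, Finset.disjoint_insert_right, Finset.disjoint_map,
        Finset.mem_insert, not_or]
      exact ⟨⟨fun h => htu (Subtype.ext (Subtype.ext h)), hnot _ _⟩, hnot _ _, hd⟩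
    · rw [Finset.card_insert_of_notMem (hnot _ _), Finset.card_map, ha]
    · rw [Finset.card_insert_of_notMem (hnot _ _), Finset.card_map, hb]

lemma isClosed_smallSets (Λ : Type*) (n : ℕ) :
    IsClosed {g : Λ → Bool | {γ | g γ = true}.Finite ∧ {γ | g γ = true}.ncard ≤ n} := by
  have h : {g : Λ → Bool | {γ | g γ = true}.Finite ∧ {γ | g γ = true}.ncard ≤ n} =
      ⋂ A ∈ {A : Finset Λ | n < A.card}, ⋃ i ∈ A, {g | g i = false} := by
    ext g
    simp only [Set.mem_ofPred_eq, Set.mem_iInter, Set.mem_iUnion, exists_prop]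
    constructor
    · rintro ⟨hf, hn⟩ A hA
      by_contra! h
      have := Set.ncard_le_ncard (s := (A : Set Λ)) (t := {γ | g γ = true})
        (fun i hi => by simpa using h i hi) hf
      rw [Set.ncard_coe_finset] at this
      omega
    · intro h
      by_contra hcon
      obtain ⟨A, hA, hc⟩ : ∃ A : Finset Λ, (A : Set Λ) ⊆ {γ | g γ = true} ∧ A.card = n + 1 := by
        by_cases hf : {γ | g γ = true}.Finite
        · have hn : n + 1 ≤ hf.toFinset.card := by
            rw [← Set.ncard_eq_toFinset_card _ hf]
            by_contra! h'
            exact hcon ⟨hf, by omega⟩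
          obtain ⟨A, hA, hc⟩ := Finset.exists_subset_card_eq hn
          exact ⟨A, fun i hi => hf.mem_toFinset.1 (hA hi), hc⟩
        · exact Set.Infinite.exists_subset_card_eq hf _
      obtain ⟨i, hi, hgi⟩ := h A (by omega)
      exact absurd (hA hi) (by simp [hgi])
  rw [h]
  refine isClosed_biInter fun A _ => A.finite_toSet.isClosed_biUnion fun i _ => ?_
  exact isClosed_eq (continuous_apply i) continuous_const

instance (Λ : Type*) (n : ℕ) : CompactSpace (smallSets Λ n) :=
  isCompact_iff_compactSpace.1 (isClosed_smallSets Λ n).isCompact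

instance (Λ : Type*) (n : ℕ) : T2Space (smallSets Λ n) :=
  inferInstanceAs (T2Space {g : Λ → Bool //
    {γ | g γ = true}.Finite ∧ {γ | g γ = true}.ncard ≤ n})

/-- The function on the sum of the `[Λ]^{≤m}` sending `B ∈ [Λ]^{≤n}` to `s * |a ∩ B|` and
vanishing on the other summands. -/
noncomputable def countSum {Λ : Type*} (n : ℕ) (s : ℝ) (a : Finset Λ)
    (x : Σ m : ℕ, smallSets Λ m) : ℝ :=
  if x.1 = n then s * ∑ i ∈ a, (if x.2.1 i then 1 else 0) else 0

lemma continuous_countSum {Λ : Type*} (n : ℕ) (s : ℝ) (a : Finset Λ) :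
    Continuous (countSum n s a) := by
  refine continuous_sigma fun m => ?_
  by_cases h : m = n
  · simp only [countSum, h, if_true]
    refine continuous_const.mul (continuous_finsetSum _ fun i _ => ?_)
    exact (continuous_of_discreteTopology (f := fun b : Bool => if b then (1 : ℝ) else 0)).comp
      ((continuous_apply i).comp continuous_subtype_val)
  · simp only [countSum, h, if_false]
    exact continuous_const

/-- The extension of `countSum` by `0` to an element of `C(K_λ)`. -/
noncomputable def countMap {Λ : Type*} (n : ℕ) (s : ℝ) (a : Finset Λ) : C(Klam Λ, ℝ) where
  toFun := fun x : OnePoint (Σ m : ℕ, smallSets Λ m) => x.elim 0 (countSum n s a)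
  continuous_toFun := by
    refine (OnePoint.continuous_iff _).2 ⟨?_, continuous_countSum n s a⟩
    refine tendsto_const_nhds.congr' ?_
    have hK : IsCompact (Set.range (Sigma.mk n : smallSets Λ n → Σ m : ℕ, smallSets Λ m)) :=
      isCompact_range continuous_sigmaMk
    filter_upwards [hK.compl_mem_coclosedCompact_of_isClosed hK.isClosed] with x hx
    obtain ⟨m, g⟩ := x
    have : m ≠ n := by
      rintro rfl
      exact hx ⟨g, rfl⟩
    simp [countSum, this]

lemma dist_countMap_insert_le {Λ : Type*} [DecidableEq Λ] (n : ℕ) {s : ℝ} (hs : 0 ≤ s)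
    (a : Finset Λ) (t : Λ) : dist (countMap n s (insert t a)) (countMap n s a) ≤ s := by
  refine (ContinuousMap.dist_le hs).2 fun x => ?_
  change dist (OnePoint.elim x 0 (countSum n s (insert t a)))
    (OnePoint.elim x 0 (countSum n s a)) ≤ s
  induction x using OnePoint.rec with
  | infty => simpa using hs
  | coe x =>
    simp only [OnePoint.elim_some, countSum]
    by_cases ht : t ∈ a
    · simpa [Finset.insert_eq_of_mem ht] using hs
    · rw [Finset.sum_insert ht, Real.dist_eq]
      split_ifs <;> simp [mul_add, abs_of_nonneg hs, hs]

lemma le_dist_countMap {Λ : Type*} (s : ℝ) (a b : Finset Λ) (h : Disjoint a b) :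
    s * a.card ≤ dist (countMap a.card s a) (countMap a.card s b) := by
  classical
  have hset : {γ | decide (γ ∈ a) = true} = (a : Set Λ) := by ext; simp
  let g : smallSets Λ a.card := ⟨fun γ => decide (γ ∈ a), by rw [hset]; exact a.finite_toSet,
    by rw [hset, Set.ncard_coe_finset]⟩
  have hb : ∀ i ∈ b, i ∉ a := fun i hi hi' => Finset.disjoint_left.1 h hi' hi
  have key : dist (countSum a.card s a ⟨_, g⟩) (countSum a.card s b ⟨_, g⟩) ≤
      dist (countMap a.card s a) (countMap a.card s b) :=
    ContinuousMap.dist_apply_le_dist (f := countMap a.card s a) (g := countMap a.card s b)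
      (OnePoint.some (⟨_, g⟩ : Σ m : ℕ, smallSets Λ m))
  refine le_trans ?_ key
  have ha1 : countSum a.card s a ⟨_, g⟩ = s * a.card := by simp [countSum, g]
  have hb1 : countSum a.card s b ⟨_, g⟩ = 0 := by
    simp only [countSum, g, if_true, decide_eq_true_eq]
    rw [Finset.sum_eq_zero fun i hi => if_neg (hb i hi), mul_zero]
  rw [ha1, hb1, Real.dist_eq, sub_zero]
  exact le_abs_self _

lemma finite_round_of_dist_le {Γ : Type*} [TopologicalSpace Γ] [DiscreteTopology Γ]
    {δ : ℝ} (hδ : 0 < δ) (w : C₀(Γ, ℝ)) :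
    {φ : Γ → ℤ | ∃ z : C₀(Γ, ℝ), dist z w < δ / 4 ∧ φ = fun γ => round (z γ / δ)}.Finite := by
  have hF : {γ | ¬ |w γ| < δ / 4}.Finite := by
    have h := w.zero_at_infty'
    rw [Filter.cocompact_eq_cofinite] at h
    have := h.eventually (Metric.ball_mem_nhds (0 : ℝ) (show 0 < δ / 4 by positivity))
    simpa [Filter.eventually_cofinite] using this
  set F := {γ | ¬ |w γ| < δ / 4}
  have hclose : ∀ z : C₀(Γ, ℝ), dist z w < δ / 4 → ∀ γ, |z γ / δ - w γ / δ| < 1 / 4 := by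
    intro z hz γ
    have h1 : |z γ - w γ| < δ / 4 :=
      (BoundedContinuousFunction.dist_coe_le_dist (f := z.toBCF) (g := w.toBCF) γ).trans_lt hz
    rw [← sub_div, abs_div, abs_of_pos hδ, div_lt_iff₀ hδ]
    linarith
  have : Finite F := hF
  refine Set.Finite.of_finite_image (f := fun φ (γ : F) => φ γ)
    ((Set.Finite.pi' fun γ : F => Set.finite_Icc ⌊w γ / δ - 1⌋ ⌈w γ / δ + 1⌉).subset ?_) ?_
  · rintro _ ⟨_, ⟨z, hz, rfl⟩, rfl⟩ γ
    have h1 := abs_lt.1 (hclose z hz γ)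
    have h2 := abs_le.1 (abs_sub_round (z γ / δ))
    constructor
    · exact_mod_cast (Int.floor_le _).trans (show w γ / δ - 1 ≤ round (z γ / δ) by linarith)
    · exact_mod_cast (show (round (z γ / δ) : ℝ) ≤ w γ / δ + 1 by linarith).trans (Int.le_ceil _)
  · have hzero : ∀ z : C₀(Γ, ℝ), dist z w < δ / 4 → ∀ γ ∉ F, round (z γ / δ) = 0 := by
      intro z hz γ hγ
      have h1 := abs_lt.1 (hclose z hz γ)
      have h3 : |w γ / δ| < 1 / 4 := by
        rw [abs_div, abs_of_pos hδ, div_lt_iff₀ hδ]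
        have : |w γ| < δ / 4 := not_not.1 hγ
        linarith
      have h3 := abs_lt.1 h3
      rw [round_eq_zero_iff]
      constructor <;> linarith
    rintro _ ⟨z, hz, rfl⟩ _ ⟨z', hz', rfl⟩ h
    funext γ
    by_cases hγ : γ ∈ F
    · exact congrFun h ⟨γ, hγ⟩
    · simp only [hzero z hz γ hγ, hzero z' hz' γ hγ]

lemma dist_le_of_round_eq {Γ : Type*} [TopologicalSpace Γ] {δ : ℝ} (hδ : 0 < δ)
    {z w : C₀(Γ, ℝ)} (h : ∀ γ, round (z γ / δ) = round (w γ / δ)) : dist z w ≤ δ := by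
  refine (BoundedContinuousFunction.dist_le (f := z.toBCF) (g := w.toBCF) hδ.le).2 fun γ => ?_
  change |z γ - w γ| ≤ δ
  have h1 := abs_le.1 (abs_sub_round (z γ / δ))
  have h2 := abs_le.1 (abs_sub_round (w γ / δ))
  rw [h γ] at h1
  have h3 : |z γ / δ - w γ / δ| ≤ 1 := abs_le.2 ⟨by linarith, by linarith⟩
  rwa [← sub_div, abs_div, abs_of_pos hδ, div_le_one hδ] at h3

theorem corollary_2_8 {Λ : Type*} (hΛ : #Λ = lam)
    {Γ : Type*} [TopologicalSpace Γ] [DiscreteTopology Γ] :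
    ¬ ∃ f : C(Klam Λ, ℝ) → C₀(Γ, ℝ), IsUniformEmbedding f := by
  classical
  rintro ⟨f, hf⟩
  obtain ⟨hunif, hinv⟩ := Metric.isUniformEmbedding_iff.1 hf |>.2
  obtain ⟨δ, hδ, hδf⟩ := hinv 1 one_pos
  obtain ⟨s', hs', hsf⟩ := Metric.uniformContinuous_iff.1 hunif (δ / 2 / 4) (by positivity)
  obtain ⟨s, hs, hss⟩ := exists_between hs'
  obtain ⟨n, hn⟩ := exists_nat_ge (1 / s)
  obtain ⟨a, b, -, -, hab, ha, -, hc⟩ := exists_disjoint_eq_color n (Set.univ : Set Λ)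
    (by rw [Cardinal.mk_univ, hΛ]; exact lamSeq_le_lam n)
    (fun a γ => round (f (countMap n s a) γ / (δ / 2)))
    (fun b => (finite_round_of_dist_le (half_pos hδ) (f (countMap n s b))).subset (by
      rintro _ ⟨t, rfl⟩
      exact ⟨_, hsf ((dist_countMap_insert_le n hs.le b t).trans_lt hss), rfl⟩))
  have h1 := hδf ((dist_le_of_round_eq (half_pos hδ) (congrFun hc)).trans_lt (half_lt_self hδ))
  subst ha
  have h2 := le_dist_countMap s a b hab
  rw [div_le_iff₀ hs] at hn
  linarith
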